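/- For every sample x = (x₁,…,xₙ) ∈ Hⁿ, the empirical Rademacher complexity satisfies 𝓡_𝓜(x) ≤ (2^{3/2}/n) · √(sup_{M∈𝓜} Σ_{i=1}^n ‖M x_i‖²) · ( 2 + √( ln ( (1/n) Σ_{i=1}^n Σ_{M∈𝓜} ‖M x_i‖² ) ) ) + 2/√n. -/

import Mathlib

open scoped ENNReal NNReal RealInnerProductSpace
open MeasureTheory ProbabilityTheory

/-- The infimum-convolution norm `‖β‖_𝓜` (with value `∞` outside `ℓ₁(𝓜)`). -/
noncomputable def Mnorm {H : Type*} [NormedAddCommGroup H] [InnerProductSpace ℝ H]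
    (𝓜 : Set (H →L[ℝ] H)) (β : H) : ℝ≥0∞ :=
  ⨅ v : {v : ↥𝓜 → H // HasSum (fun M : ↥𝓜 => (M : H →L[ℝ] H) (v M)) β},
    ∑' M : ↥𝓜, (‖v.1 M‖₊ : ℝ≥0∞)

/-- The empirical Rademacher complexity `𝓡_𝓜(x)`, with the expectation over the
Rademacher variables written as a uniform average over sign patterns. -/
noncomputable def radComp {H : Type*} [NormedAddCommGroup H] [InnerProductSpace ℝ H]
    (𝓜 : Set (H →L[ℝ] H)) {n : ℕ} (x : Fin n → H) : ℝ :=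
  (2 / n) * ((∑ σ : Fin n → Bool,
    sSup {r : ℝ | ∃ β : H, Mnorm 𝓜 β ≤ 1 ∧
      r = ∑ i, (if σ i then (1 : ℝ) else -1) * ⟪β, x i⟫}) / 2 ^ n)

/-- A convex function on `[0, ∞)` has larger symmetric sums around `c` at larger distances. -/
lemma ConvexOn.add_sub_le_of_abs_le {f : ℝ → ℝ} (hf : ConvexOn ℝ (Set.Ici 0) f)
    {c s r : ℝ} (hs : |s| ≤ r) (hr : r ≤ c) :
    f (c + s) + f (c - s) ≤ f (c + r) + f (c - r) := by
  obtain ⟨h₁, h₂⟩ := abs_le.mp hs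
  rcases (abs_nonneg s |>.trans hs).eq_or_lt with h0 | h0
  · have : s = 0 := by linarith
    subst this
    simp [← h0]
  have key (t : ℝ) (ht₁ : -r ≤ t) (ht₂ : t ≤ r) :
      f (c + t) ≤ (r + t) / (2 * r) * f (c + r) + (r - t) / (2 * r) * f (c - r) := by
    have hp : c + r ∈ Set.Ici (0 : ℝ) := Set.mem_Ici.2 (by linarith)
    have hm : c - r ∈ Set.Ici (0 : ℝ) := Set.mem_Ici.2 (by linarith)
    have := hf.2 hp hm
      (show 0 ≤ (r + t) / (2 * r) from div_nonneg (by linarith) (by linarith))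
      (show 0 ≤ (r - t) / (2 * r) from div_nonneg (by linarith) (by linarith))
      (by field_simp; ring)
    simp only [smul_eq_mul] at this
    rwa [show (r + t) / (2 * r) * (c + r) + (r - t) / (2 * r) * (c - r) = c + t by
      field_simp; ring] at this
  have k₁ := key s h₁ h₂
  have k₂ := key (-s) (by linarith) (by linarith)
  rw [← sub_eq_add_neg] at k₂
  calc _ ≤ _ := add_le_add k₁ k₂
    _ = _ := by field_simp; ring

/-- Two-point inequality for the hyperbolic cosine of the norm. -/
lemma cosh_norm_add_add_cosh_norm_sub_le {H : Type*} [NormedAddCommGroup H]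
    [InnerProductSpace ℝ H] (u y : H) :
    Real.cosh ‖u + y‖ + Real.cosh ‖u - y‖ ≤ 2 * (Real.cosh ‖u‖ * Real.cosh ‖y‖) := by
  have h : 2 * (Real.cosh ‖u‖ * Real.cosh ‖y‖)
      = Real.cosh (‖u‖ + ‖y‖) + Real.cosh (‖u‖ - ‖y‖) := by
    rw [Real.cosh_add, Real.cosh_sub]; ring
  rw [h]
  refine hasSum_le (fun k => ?_) ((Real.hasSum_cosh ‖u + y‖).add (Real.hasSum_cosh ‖u - y‖))
    ((Real.hasSum_cosh (‖u‖ + ‖y‖)).add (Real.hasSum_cosh (‖u‖ - ‖y‖)))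
  rw [← add_div, ← add_div]
  refine div_le_div_of_nonneg_right ?_ (Nat.cast_nonneg _)
  simp only [pow_mul]
  have := (convexOn_pow (𝕜 := ℝ) k).add_sub_le_of_abs_le (c := ‖u‖ ^ 2 + ‖y‖ ^ 2)
    (s := 2 * ⟪u, y⟫) (r := 2 * (‖u‖ * ‖y‖))
    (by rw [abs_mul, abs_two]; gcongr; exact abs_real_inner_le_norm u y)
    (by nlinarith [sq_nonneg (‖u‖ - ‖y‖)])
  rw [norm_add_sq_real, norm_sub_sq_real, add_sq, sub_sq]
  ring_nf at this ⊢
  exact this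

/-- Sub-Gaussian estimate for the norm of a Rademacher sum in an inner product space. -/
lemma sum_cosh_norm_signed_sum_le {H : Type*} [NormedAddCommGroup H] [InnerProductSpace ℝ H]
    {n : ℕ} (y : Fin n → H) :
    ∑ σ : Fin n → Bool, Real.cosh ‖∑ i, (if σ i then (1 : ℝ) else -1) • y i‖
      ≤ 2 ^ n * Real.exp ((∑ i, ‖y i‖ ^ 2) / 2) := by
  induction n with
  | zero => simp
  | succ n ih =>
    rw [← (Fin.consEquiv fun _ : Fin (n + 1) => Bool).sum_comp, Fintype.sum_prod_type_right]
    simp only [Fin.consEquiv_apply, Fin.sum_univ_succ, Fin.cons_zero, Fin.cons_succ,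
      Fintype.sum_bool]
    calc _ ≤ ∑ σ : Fin n → Bool, 2 * (Real.exp (‖y 0‖ ^ 2 / 2) *
          Real.cosh ‖∑ i, (if σ i then (1 : ℝ) else -1) • y i.succ‖) := by
          refine Finset.sum_le_sum fun σ _ => ?_
          have := cosh_norm_add_add_cosh_norm_sub_le
            (∑ i, (if σ i then (1 : ℝ) else -1) • y i.succ) (y 0)
          have h₂ := mul_le_mul_of_nonneg_right (Real.cosh_le_exp_half_sq ‖y 0‖)
            (Real.cosh_pos ‖∑ i, (if σ i then (1 : ℝ) else -1) • y i.succ‖).le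
          simp only [if_true, Bool.false_eq_true, if_false, one_smul, neg_smul]
          rw [add_comm (y 0), neg_add_eq_sub]
          linarith
      _ = 2 * Real.exp (‖y 0‖ ^ 2 / 2) * ∑ σ : Fin n → Bool,
          Real.cosh ‖∑ i, (if σ i then (1 : ℝ) else -1) • y i.succ‖ := by
          rw [Finset.mul_sum]; simp only [mul_assoc]
      _ ≤ 2 * Real.exp (‖y 0‖ ^ 2 / 2) *
          (2 ^ n * Real.exp ((∑ i : Fin n, ‖y i.succ‖ ^ 2) / 2)) := by
          gcongr; exact ih _
      _ = _ := by rw [add_div, Real.exp_add]; ring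

/-- The mean excess of the norm of a Rademacher sum over a level `s`. -/
lemma sum_excess_norm_signed_sum_le {H : Type*} [NormedAddCommGroup H] [InnerProductSpace ℝ H]
    {n : ℕ} (y : Fin n → H) {s : ℝ} (hs : 0 < s) (ha : 0 < ∑ i, ‖y i‖ ^ 2) :
    ∑ σ : Fin n → Bool, max (‖∑ i, (if σ i then (1 : ℝ) else -1) • y i‖ - s) 0
      ≤ 2 ^ n * ((∑ i, ‖y i‖ ^ 2) / s * Real.exp (-(s ^ 2 / (2 * ∑ i, ‖y i‖ ^ 2)))) := by
  set a := ∑ i, ‖y i‖ ^ 2 with ha_def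
  have hl : 0 < s / a := by positivity
  have hpt (r : ℝ) : max (r - s) 0
      ≤ a / s * Real.exp (-(s ^ 2 / a)) * Real.cosh (s / a * r) := by
    have he : (2 : ℝ) ≤ Real.exp 1 := by linarith [Real.add_one_le_exp (1 : ℝ)]
    have h₁ : s / a * (r - s) ≤ Real.exp (-(s ^ 2 / a)) * Real.cosh (s / a * r) := by
      have h₂ := Real.add_one_le_exp (s / a * (r - s) - 1)
      have h₃ : Real.exp (s / a * (r - s) - 1) * Real.exp 1
          = Real.exp (-(s ^ 2 / a)) * Real.exp (s / a * r) := by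
        rw [← Real.exp_add, ← Real.exp_add]; congr 1; field_simp; ring
      have h₄ : Real.exp (s / a * r) ≤ 2 * Real.cosh (s / a * r) := by
        rw [Real.cosh_eq]; linarith [Real.exp_pos (-(s / a * r))]
      have h₅ := Real.exp_pos (-(s ^ 2 / a))
      have h₆ := Real.exp_pos (s / a * (r - s) - 1)
      nlinarith [mul_le_mul_of_nonneg_left h₄ h₅.le, mul_le_mul_of_nonneg_left he h₆.le]
    refine max_le ?_ (by have := Real.cosh_pos (s / a * r); positivity)
    calc r - s = a / s * (s / a * (r - s)) := by field_simp
      _ ≤ a / s * (Real.exp (-(s ^ 2 / a)) * Real.cosh (s / a * r)) := by gcongr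
      _ = _ := by ring
  have hc := sum_cosh_norm_signed_sum_le fun i => (s / a) • y i
  have hn (σ : Fin n → Bool) : ‖∑ i, (if σ i then (1 : ℝ) else -1) • (s / a) • y i‖
      = s / a * ‖∑ i, (if σ i then (1 : ℝ) else -1) • y i‖ := by
    simp_rw [smul_comm _ (s / a)]
    rw [← Finset.smul_sum, norm_smul, Real.norm_of_nonneg hl.le]
  have hq : (∑ i, ‖(s / a) • y i‖ ^ 2) / 2 = s ^ 2 / (2 * a) := by
    simp_rw [norm_smul, mul_pow, ← Finset.mul_sum, ← ha_def, Real.norm_of_nonneg hl.le]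
    field_simp
  rw [hq] at hc
  simp_rw [hn] at hc
  calc _ ≤ ∑ σ : Fin n → Bool, a / s * Real.exp (-(s ^ 2 / a)) *
        Real.cosh (s / a * ‖∑ i, (if σ i then (1 : ℝ) else -1) • y i‖) :=
        Finset.sum_le_sum fun σ _ => hpt _
    _ ≤ a / s * Real.exp (-(s ^ 2 / a)) * (2 ^ n * Real.exp (s ^ 2 / (2 * a))) := by
        rw [← Finset.mul_sum]; gcongr
    _ = 2 ^ n * (a / s * (Real.exp (-(s ^ 2 / a)) * Real.exp (s ^ 2 / (2 * a)))) := by ring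
    _ = _ := by
        rw [← Real.exp_add]; congr 3; field_simp; ring

/-- The dual norm of `Mnorm 𝓜` is at most `sup_M ‖M S‖`. -/
lemma inner_le_of_Mnorm_le_one {H : Type*} [NormedAddCommGroup H] [InnerProductSpace ℝ H]
    {𝓜 : Set (H →L[ℝ] H)} (hsym : ∀ M ∈ 𝓜, ∀ x y : H, ⟪M x, y⟫ = ⟪x, M y⟫)
    {β S : H} {B : ℝ} (hB₀ : 0 ≤ B) (hB : ∀ M ∈ 𝓜, ‖M S‖ ≤ B) (hβ : Mnorm 𝓜 β ≤ 1) :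
    ⟪β, S⟫ ≤ B := by
  have key (ε : ℝ) (hε : 0 < ε) : ⟪β, S⟫ ≤ (1 + ε) * B := by
    have hlt : Mnorm 𝓜 β < ENNReal.ofReal (1 + ε) :=
      hβ.trans_lt (ENNReal.one_lt_ofReal.2 (by linarith))
    obtain ⟨⟨v, hv⟩, hlt⟩ := iInf_lt_iff.mp hlt
    have hsv : Summable fun M => ‖v M‖₊ := ENNReal.tsum_coe_ne_top_iff_summable.mp hlt.ne_top
    have hsv' : Summable fun M => ‖v M‖ := NNReal.summable_coe.2 hsv
    have hle : ∑' M, ‖v M‖ ≤ 1 + ε := by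
      have h := (ENNReal.toReal_le_of_le_ofReal (by linarith) hlt.le)
      rw [← ENNReal.coe_tsum hsv] at h
      simpa [NNReal.coe_tsum] using h
    have h₁ : HasSum (fun M : 𝓜 => ⟪v M, (M : H →L[ℝ] H) S⟫) ⟪β, S⟫ := by
      have := hv.mapL (innerSL ℝ S)
      simp only [innerSL_apply_apply, real_inner_comm _ S] at this
      rwa [funext fun M : 𝓜 => hsym M.1 M.2 (v M) S] at this
    calc ⟪β, S⟫ ≤ (∑' M, ‖v M‖) * B :=
          hasSum_le (fun M : 𝓜 => (real_inner_le_norm _ _).trans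
            (mul_le_mul_of_nonneg_left (hB M.1 M.2) (norm_nonneg _))) h₁ (hsv'.hasSum.mul_right B)
      _ ≤ (1 + ε) * B := by gcongr
  refine le_of_forall_pos_le_add fun δ hδ => ?_
  refine (key (δ / (B + 1)) (by positivity)).trans ?_
  have : δ / (B + 1) * B ≤ δ := by
    rw [div_mul_eq_mul_div, div_le_iff₀ (by linarith)]; nlinarith
  linarith

/-- Corollary 3: `𝓡_𝓜(x) ≤ (2^{3/2}/n) √(sup_M Σ_i ‖M x_i‖²)
(2 + √(ln((1/n) Σ_i Σ_M ‖M x_i‖²))) + 2/√n`. -/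
theorem rademacher_corollary_bound
    {H : Type*} [NormedAddCommGroup H] [InnerProductSpace ℝ H] [CompleteSpace H]
    (𝓜 : Set (H →L[ℝ] H)) [Countable ↥𝓜]
    (hsym : ∀ M ∈ 𝓜, ∀ x y : H, ⟪M x, y⟫ = ⟪x, M y⟫)
    (hnondeg : ∀ x : H, x ≠ 0 → ∃ M ∈ 𝓜, M x ≠ 0)
    (C₀ : ℝ) (hbdd : ∀ M ∈ 𝓜, ‖M‖ ≤ C₀)
    {n : ℕ} (hn : 0 < n) (x : Fin n → H)
    (hsum : ∀ i, Summable fun M : ↥𝓜 => ‖(M : H →L[ℝ] H) (x i)‖ ^ 2) :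
    radComp 𝓜 x ≤
      (2 ^ ((3 : ℝ) / 2) / n) *
        Real.sqrt (⨆ M : ↥𝓜, ∑ i, ‖(M : H →L[ℝ] H) (x i)‖ ^ 2) *
        (2 + Real.sqrt (Real.log
          ((1 / n) * ∑ i, ∑' M : ↥𝓜, ‖(M : H →L[ℝ] H) (x i)‖ ^ 2)))
      + 2 / Real.sqrt n := by
  set a : 𝓜 → ℝ := fun M => ∑ i, ‖(M : H →L[ℝ] H) (x i)‖ ^ 2
  have ha_sum : Summable a := summable_sum fun i _ => hsum i
  have ha_nonneg (M : 𝓜) : 0 ≤ a M := Finset.sum_nonneg fun i _ => sq_nonneg _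
  have hT : ∑ i, ∑' M : 𝓜, ‖(M : H →L[ℝ] H) (x i)‖ ^ 2 = ∑' M, a M :=
    (Summable.tsum_finsetSum fun i _ => hsum i).symm
  rw [hT]
  set T := ∑' M, a M
  set A := ⨆ M, a M
  have hT_nonneg : 0 ≤ T := tsum_nonneg ha_nonneg
  have haA (M : 𝓜) : a M ≤ A :=
    le_ciSup (f := a) ⟨T, by rintro _ ⟨M, rfl⟩; exact ha_sum.le_tsum M fun _ _ => ha_nonneg _⟩ M
  have hA_nonneg : 0 ≤ A := Real.iSup_nonneg ha_nonneg
  set L := Real.log (1 / n * T)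
  have hn' : (0 : ℝ) < n := by exact_mod_cast hn
  have hsn : 0 < √(n : ℝ) := Real.sqrt_pos.2 hn'
  have hsn2 : √(n : ℝ) ^ 2 = n := Real.sq_sqrt hn'.le
  have hTL : T * Real.exp (-L) ≤ n := by
    rcases hT_nonneg.eq_or_lt with h | h
    · simp [← h]
    · rw [Real.exp_neg, Real.exp_log (by positivity)]
      field_simp; rfl
  set w := √2 * √A * (2 + √L)
  set s := w + √(n : ℝ) / 2
  have hw : 0 ≤ w := by positivity
  have hs : 0 < s := by positivity
  set S : (Fin n → Bool) → H := fun σ => ∑ i, (if σ i then (1 : ℝ) else -1) • x i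
  set g : (Fin n → Bool) → 𝓜 → ℝ := fun σ M => max (‖(M : H →L[ℝ] H) (S σ)‖ - s) 0
  set K := Real.exp (-(4 + L)) / s
  have hg_nonneg (σ M) : 0 ≤ g σ M := le_max_right _ _
  have hg (M : 𝓜) : ∑ σ, g σ M ≤ 2 ^ n * (a M * K) := by
    have hMS (σ) : (M : H →L[ℝ] H) (S σ)
        = ∑ i, (if σ i then (1 : ℝ) else -1) • (M : H →L[ℝ] H) (x i) := by
      simp only [S, map_sum, map_smul]
    simp only [g, hMS]
    rcases (ha_nonneg M).eq_or_lt with h | h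
    · have h0 (i) : (M : H →L[ℝ] H) (x i) = 0 := by
        have := (Finset.sum_eq_zero_iff_of_nonneg fun i _ => sq_nonneg _).mp h.symm i
          (Finset.mem_univ i)
        simpa using this
      simp [h0, ← h, hs.le]
    · refine (sum_excess_norm_signed_sum_le _ hs h).trans ?_
      have hexp : 4 + L ≤ s ^ 2 / (2 * a M) := by
        rw [le_div_iff₀ (by positivity)]
        have hL : L ≤ √L ^ 2 := by
          rcases le_total 0 L with h | h
          · rw [Real.sq_sqrt h]
          · exact h.trans (sq_nonneg _)
        have hsL := Real.sqrt_nonneg L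
        have hw2 : w ^ 2 = 2 * A * (2 + √L) ^ 2 := by
          simp only [w, mul_pow, Real.sq_sqrt hA_nonneg, Real.sq_sqrt zero_le_two]
        calc (4 + L) * (2 * a M) ≤ (2 + √L) ^ 2 * (2 * a M) := by gcongr; nlinarith
          _ ≤ (2 + √L) ^ 2 * (2 * A) := by gcongr; exact haA M
          _ = w ^ 2 := by rw [hw2]; ring
          _ ≤ s ^ 2 := by gcongr; simp only [s]; linarith
      calc _ ≤ 2 ^ n * (a M / s * Real.exp (-(4 + L))) := by gcongr
        _ = _ := by simp only [K]; ring
  have hg_sum (σ) : Summable (g σ) :=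
    Summable.of_nonneg_of_le (hg_nonneg σ)
      (fun M => (Finset.single_le_sum (f := fun σ => g σ M) (fun σ _ => hg_nonneg σ M)
        (Finset.mem_univ σ)).trans (hg M)) ((ha_sum.mul_right K).mul_left _)
  have hsup (σ : Fin n → Bool) : sSup {r : ℝ | ∃ β : H, Mnorm 𝓜 β ≤ 1 ∧
      r = ∑ i, (if σ i then (1 : ℝ) else -1) * ⟪β, x i⟫} ≤ s + ∑' M, g σ M := by
    have hB : 0 ≤ s + ∑' M, g σ M := add_nonneg hs.le (tsum_nonneg (hg_nonneg σ))
    refine Real.sSup_le ?_ hB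
    rintro _ ⟨β, hβ, rfl⟩
    have : ∑ i, (if σ i then (1 : ℝ) else -1) * ⟪β, x i⟫ = ⟪β, S σ⟫ := by
      simp only [S, inner_sum, inner_smul_right]
    rw [this]
    refine inner_le_of_Mnorm_le_one hsym hB (fun M hM => ?_) hβ
    have h₁ := (hg_sum σ).le_tsum ⟨M, hM⟩ fun _ _ => hg_nonneg σ _
    have h₂ : ‖M (S σ)‖ - s ≤ g σ ⟨M, hM⟩ := le_max_left _ _
    linarith
  have hTK : T * K ≤ √(n : ℝ) / 2 := by
    have he : (4 : ℝ) ≤ Real.exp 4 := by linarith [Real.add_one_le_exp (4 : ℝ)]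
    have h₁ : T * Real.exp (-(4 + L)) ≤ n / 4 := by
      rw [neg_add, Real.exp_add, Real.exp_neg 4]
      calc T * ((Real.exp 4)⁻¹ * Real.exp (-L)) = (T * Real.exp (-L)) * (Real.exp 4)⁻¹ := by ring
        _ ≤ n * (4 : ℝ)⁻¹ := by gcongr
        _ = _ := by ring
    rw [show T * K = T * Real.exp (-(4 + L)) / s by simp only [K]; ring, div_le_iff₀ hs]
    have : √(n : ℝ) / 2 * s = √(n : ℝ) / 2 * w + √(n : ℝ) ^ 2 / 4 := by simp only [s]; ring
    rw [this, hsn2]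
    have : 0 ≤ √(n : ℝ) / 2 * w := by positivity
    linarith
  have havg : (∑ σ : Fin n → Bool, sSup {r : ℝ | ∃ β : H, Mnorm 𝓜 β ≤ 1 ∧
      r = ∑ i, (if σ i then (1 : ℝ) else -1) * ⟪β, x i⟫}) / 2 ^ n ≤ w + √(n : ℝ) := by
    rw [div_le_iff₀ (by positivity)]
    calc _ ≤ ∑ σ : Fin n → Bool, (s + ∑' M, g σ M) := Finset.sum_le_sum fun σ _ => hsup σ
      _ = 2 ^ n * s + ∑' M, ∑ σ, g σ M := by
          rw [Finset.sum_add_distrib, Summable.tsum_finsetSum fun σ _ => hg_sum σ]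
          simp
      _ ≤ 2 ^ n * s + ∑' M, 2 ^ n * (a M * K) := by
          gcongr
          · exact summable_sum fun σ _ => hg_sum σ
          · exact (ha_sum.mul_right K).mul_left _
          · exact hg _
      _ = 2 ^ n * (s + T * K) := by rw [tsum_mul_left, tsum_mul_right]; ring
      _ ≤ 2 ^ n * (w + √(n : ℝ)) := by exact mul_le_mul_of_nonneg_left (by simp only [s]; linarith) (by positivity)
      _ = _ := mul_comm _ _
  have h32 : (2 : ℝ) ^ ((3 : ℝ) / 2) = 2 * √2 := by
    rw [show (3 : ℝ) / 2 = 1 + 1 / 2 by norm_num, Real.rpow_add two_pos, Real.rpow_one,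
      Real.sqrt_eq_rpow]
  calc radComp 𝓜 x ≤ 2 / n * (w + √(n : ℝ)) := by unfold radComp; gcongr
    _ = _ := by
      have : 2 / n * √(n : ℝ) = 2 / √(n : ℝ) := by
        nth_rewrite 1 [← hsn2]; field_simp
      rw [mul_add, this, h32]; simp only [w]; ring
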